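/- Fix a variety v. Among the other 29 varieties: exactly one variety (the mirror variety v*) shares all three opposite pairs and no corner triples with v; exactly twelve varieties share exactly one opposite pair and exactly two corner triples with v; exactly eight varieties share no opposite pairs and exactly two corner triples with v; and exactly eight varieties share no opposite pairs and no corner triples with v. -/

import Mathlib

open scoped Classical

/-- A colored cube: a bijection assigning to each face (`Fin 6`) a color (`Fin 6`). -/
abbrev CCube := Equiv.Perm (Fin 6)

/-- The opposite-face involution: face `i` is opposite face `i + 3`. -/
def tau (i : Fin 6) : Fin 6 := i + 3

/-- Quarter-turn rotation about the axis through the face pair `{2, 5}`. -/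
def r1 : Equiv.Perm (Fin 6) := ([0, 1, 3, 4] : List (Fin 6)).formPerm

/-- Quarter-turn rotation about the axis through the face pair `{0, 3}`. -/
def r2 : Equiv.Perm (Fin 6) := ([1, 2, 4, 5] : List (Fin 6)).formPerm

/-- The rotation group of the cube, acting on the set of faces. -/
def G : Subgroup (Equiv.Perm (Fin 6)) := Subgroup.closure {r1, r2}

/-- Two colored cubes have the same variety iff one is obtained from the other by
precomposition with a rotation. -/
def sameVariety (c d : CCube) : Prop := ∃ g ∈ G, d = c * g

def varietySetoid : Setoid CCube where
  r := sameVariety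
  iseqv := by
    refine ⟨fun c => ⟨1, G.one_mem, (mul_one c).symm⟩, ?_, ?_⟩
    · rintro c d ⟨g, hg, rfl⟩
      exact ⟨g⁻¹, G.inv_mem hg, by group⟩
    · rintro a b c ⟨g, hg, rfl⟩ ⟨h, hh, rfl⟩
      exact ⟨g * h, G.mul_mem hg hh, by group⟩

/-- A variety is a `G`-orbit of colored cubes. -/
def Variety := Quotient varietySetoid

/-- The variety of a colored cube. -/
def varietyOf (c : CCube) : Variety := Quotient.mk varietySetoid c

/-- The three opposite pairs of colors of a colored cube. -/
def oppPairs (c : CCube) : Finset (Finset (Fin 6)) :=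
  Finset.image (fun i => ({c i, c (tau i)} : Finset (Fin 6))) Finset.univ

/-- The twelve adjacent pairs of colors of a colored cube. -/
def adjPairs (c : CCube) : Finset (Finset (Fin 6)) :=
  Finset.image (fun p : Fin 6 × Fin 6 => ({c p.1, c p.2} : Finset (Fin 6)))
    (Finset.univ.filter (fun p : Fin 6 × Fin 6 => p.2 ≠ p.1 ∧ p.2 ≠ tau p.1))

/-- The mirror cube of `c`. -/
def mirror (c : CCube) : CCube := c * Equiv.swap 0 3

/-- Cyclic rotation of an ordered triple. -/
def cyc (t : Fin 6 × Fin 6 × Fin 6) : Fin 6 × Fin 6 × Fin 6 := (t.2.1, t.2.2, t.1)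

/-- The cyclic equivalence class of an ordered triple. -/
def cycClass (t : Fin 6 × Fin 6 × Fin 6) : Finset (Fin 6 × Fin 6 × Fin 6) :=
  {t, cyc t, cyc (cyc t)}

/-- The eight corner triples of a colored cube: faces `0, 1, 2` meet at a corner, read
clockwise, and the corners of the cube are the images of this corner under rotations. -/
noncomputable def cornerTriples (c : CCube) : Finset (Finset (Fin 6 × Fin 6 × Fin 6)) :=
  Finset.univ.filter (fun s => ∃ g ∈ G, s = cycClass (c (g 0), c (g 1), c (g 2)))

/-- The opposite pairs of a variety. -/
noncomputable def vOpp (v : Variety) : Finset (Finset (Fin 6)) := oppPairs (Quotient.out v)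

/-- The adjacent pairs of a variety. -/
noncomputable def vAdj (v : Variety) : Finset (Finset (Fin 6)) := adjPairs (Quotient.out v)

/-- The corner triples of a variety. -/
noncomputable def vCorners (v : Variety) : Finset (Finset (Fin 6 × Fin 6 × Fin 6)) :=
  cornerTriples (Quotient.out v)

/-- The mirror variety of a variety. -/
noncomputable def vMirror (v : Variety) : Variety := varietyOf (mirror (Quotient.out v))

/-- A pentad: five varieties which pairwise share no corner triples and whose fifteen
opposite pairs comprise each unordered pair of colors exactly once. -/
def IsPentad (P : Finset Variety) : Prop :=
  P.card = 5 ∧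
  (∀ v ∈ P, ∀ w ∈ P, v ≠ w → vCorners v ∩ vCorners w = ∅) ∧
  (∀ p : Finset (Fin 6), p.card = 2 → ∃! v, v ∈ P ∧ p ∈ vOpp v)

/-- A corner solution from the multiset `S` modeled on the cube `m`: eight distinct cube
instances from `S` in bijection with the eight corner triples of `m`, each chosen cube having
its assigned corner triple among its own corner triples. -/
def CornerSolutionOn (S : Multiset CCube) (m : CCube) : Prop :=
  ∃ ψ : Finset (Fin 6 × Fin 6 × Fin 6) → CCube,
    Multiset.map ψ (cornerTriples m).val ≤ S ∧
    ∀ t ∈ cornerTriples m, t ∈ cornerTriples (ψ t)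

/-- `S` contains a corner solution modeled on some variety. -/
def HasCornerSolution (S : Multiset CCube) : Prop := ∃ m : CCube, CornerSolutionOn S m

/-- An `n`-frame solution from `S` modeled on the cube `m`: a corner solution together with,
for each of the twelve adjacent pairs of `m`, a further `n - 2` cube instances having that
adjacent pair, all `12n - 16` cube instances distinct. -/
def FrameSolutionOn (n : ℕ) (S : Multiset CCube) (m : CCube) : Prop :=
  ∃ (ψ : Finset (Fin 6 × Fin 6 × Fin 6) → CCube) (f : Finset (Fin 6) → Multiset CCube),
    (∀ t ∈ cornerTriples m, t ∈ cornerTriples (ψ t)) ∧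
    (∀ p ∈ adjPairs m, Multiset.card (f p) = n - 2 ∧ ∀ x ∈ f p, p ∈ adjPairs x) ∧
    Multiset.map ψ (cornerTriples m).val + (adjPairs m).sum f ≤ S

/-- `S` contains an `n`-frame solution modeled on some variety. -/
def HasFrameSolution (n : ℕ) (S : Multiset CCube) : Prop := ∃ m : CCube, FrameSolutionOn n S m

/-- The 24 rotations, listed as a rotation carrying face `0` to a given face, precomposed with
a rotation about the axis through face `0`. -/
def rotations : Finset (Equiv.Perm (Fin 6)) :=
  Finset.univ.image fun p : Fin 6 × Fin 4 =>
    ![1, r1, r2 * r1, r1 ^ 2, r1 ^ 3, r2 ^ 3 * r1] p.1 * r2 ^ (p.2 : ℕ)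

theorem mul_mem_rotations : ∀ x ∈ rotations,
    r1 * x ∈ rotations ∧ r2 * x ∈ rotations ∧ r1⁻¹ * x ∈ rotations ∧ r2⁻¹ * x ∈ rotations := by
  decide +kernel

theorem r1_mem_G : r1 ∈ G := Subgroup.subset_closure (by simp)

theorem r2_mem_G : r2 ∈ G := Subgroup.subset_closure (by simp)

theorem mem_G_iff {g : Equiv.Perm (Fin 6)} : g ∈ G ↔ g ∈ rotations := by
  constructor
  · intro hg
    induction hg using Subgroup.closure_induction_left with
    | one => decide +kernel
    | mul_left x hx y _ ih =>
      rcases hx with rfl | rfl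
      exacts [(mul_mem_rotations y ih).1, (mul_mem_rotations y ih).2.1]
    | inv_mul_cancel x hx y _ ih =>
      rcases hx with rfl | rfl
      exacts [(mul_mem_rotations y ih).2.2.1, (mul_mem_rotations y ih).2.2.2]
  · intro hg
    obtain ⟨⟨i, j⟩, -, rfl⟩ := Finset.mem_image.1 hg
    refine G.mul_mem ?_ (G.pow_mem r2_mem_G _)
    fin_cases i
    exacts [G.one_mem, r1_mem_G, G.mul_mem r2_mem_G r1_mem_G, G.pow_mem r1_mem_G _,
      G.pow_mem r1_mem_G _, G.mul_mem (G.pow_mem r2_mem_G _) r1_mem_G]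

theorem card_rotations : rotations.card = 24 := by decide +kernel

theorem apply_tau_of_mem_G {g : Equiv.Perm (Fin 6)} (hg : g ∈ G) (i : Fin 6) :
    g (tau i) = tau (g i) := by
  have h : ∀ g ∈ rotations, ∀ i, g (tau i) = tau (g i) := by decide +kernel
  exact h g (mem_G_iff.1 hg) i

theorem oppPairs_mul_of_mem_G (c : CCube) {g : Equiv.Perm (Fin 6)} (hg : g ∈ G) :
    oppPairs (c * g) = oppPairs c := by
  ext s
  simp only [oppPairs, Finset.mem_image, Finset.mem_univ, true_and, Equiv.Perm.mul_apply,
    apply_tau_of_mem_G hg]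
  exact g.surjective.exists (p := fun i => ({c i, c (tau i)} : Finset (Fin 6)) = s) |>.symm

theorem mem_cornerTriples {c : CCube} {s : Finset (Fin 6 × Fin 6 × Fin 6)} :
    s ∈ cornerTriples c ↔ ∃ g ∈ G, s = cycClass (c (g 0), c (g 1), c (g 2)) := by
  simp [cornerTriples]

theorem cornerTriples_mul_of_mem_G (c : CCube) {g : Equiv.Perm (Fin 6)} (hg : g ∈ G) :
    cornerTriples (c * g) = cornerTriples c := by
  ext s
  simp only [mem_cornerTriples]
  constructor
  · rintro ⟨h, hh, rfl⟩
    exact ⟨g * h, G.mul_mem hg hh, rfl⟩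
  · rintro ⟨h, hh, rfl⟩
    exact ⟨g⁻¹ * h, G.mul_mem (G.inv_mem hg) hh, by simp⟩

theorem varietyOf_eq_iff {c d : CCube} : varietyOf c = varietyOf d ↔ c⁻¹ * d ∈ G := by
  refine Quotient.eq.trans ⟨?_, fun h => ⟨_, h, by group⟩⟩
  rintro ⟨g, hg, rfl⟩
  simpa using hg

theorem exists_out_varietyOf (c : CCube) :
    ∃ g ∈ G, Quotient.out (varietyOf c) = c * g :=
  Quotient.exact (s := varietySetoid) (Quotient.out_eq (varietyOf c)).symm

theorem vOpp_varietyOf (c : CCube) : vOpp (varietyOf c) = oppPairs c := by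
  obtain ⟨g, hg, h⟩ := exists_out_varietyOf c
  rw [vOpp, h, oppPairs_mul_of_mem_G c hg]

theorem vCorners_varietyOf (c : CCube) : vCorners (varietyOf c) = cornerTriples c := by
  obtain ⟨g, hg, h⟩ := exists_out_varietyOf c
  rw [vCorners, h, cornerTriples_mul_of_mem_G c hg]

theorem oppPairs_mul (c d : CCube) :
    oppPairs (c * d) = (oppPairs d).image (Finset.image c) := by
  simp [oppPairs, Finset.image_image, Function.comp_def, Finset.image_insert]

theorem image_cycClass (c : Fin 6 → Fin 6) (x y z : Fin 6) :
    (cycClass (x, y, z)).image (Prod.map c (Prod.map c c)) = cycClass (c x, c y, c z) := by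
  simp [cycClass, cyc, Finset.image_insert]

theorem cornerTriples_mul (c d : CCube) :
    cornerTriples (c * d) =
      (cornerTriples d).image (Finset.image (Prod.map c (Prod.map c c))) := by
  ext s
  simp only [Finset.mem_image, mem_cornerTriples]
  constructor
  · rintro ⟨g, hg, rfl⟩
    exact ⟨_, ⟨g, hg, rfl⟩, image_cycClass ..⟩
  · rintro ⟨_, ⟨g, hg, rfl⟩, rfl⟩
    exact ⟨g, hg, image_cycClass ..⟩

theorem card_oppPairs_inter_mul (c d : CCube) :
    (oppPairs c ∩ oppPairs (c * d)).card = (oppPairs 1 ∩ oppPairs d).card := by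
  have hc := Finset.image_injective c.injective
  conv_lhs => rw [← mul_one c, mul_assoc, one_mul, oppPairs_mul, oppPairs_mul c d]
  rw [← Finset.image_inter _ _ hc, Finset.card_image_of_injective _ hc]

theorem card_cornerTriples_inter_mul (c d : CCube) :
    (cornerTriples c ∩ cornerTriples (c * d)).card =
      (cornerTriples 1 ∩ cornerTriples d).card := by
  have hc := Finset.image_injective
    (c.injective.prodMap (c.injective.prodMap c.injective))
  conv_lhs => rw [← mul_one c, mul_assoc, one_mul, cornerTriples_mul, cornerTriples_mul c d]
  rw [← Finset.image_inter _ _ hc, Finset.card_image_of_injective _ hc]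

/-- The corner triples of a colored cube, in a form that can be evaluated. -/
def explicitCornerTriples (c : CCube) : Finset (Finset (Fin 6 × Fin 6 × Fin 6)) :=
  rotations.image fun g => cycClass (c (g 0), c (g 1), c (g 2))

theorem cornerTriples_eq_explicit (c : CCube) : cornerTriples c = explicitCornerTriples c := by
  ext s
  simp [mem_cornerTriples, explicitCornerTriples, mem_G_iff, eq_comm]

/-- Representatives of the 30 left cosets of the rotation group. -/
def cosetRep (p : Fin 5 × Fin 3 × Fin 2) : Equiv.Perm (Fin 6) :=
  Equiv.swap 3 (![3, 1, 2, 4, 5] p.1) * Equiv.swap 2 (![2, 4, 5] p.2.1) *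
    Equiv.swap 4 (![4, 5] p.2.2)

theorem cosetRep_inv_mul_mem : ∀ p q, (cosetRep p)⁻¹ * cosetRep q ∈ rotations → p = q := by
  decide +kernel

theorem exists_cosetRep_inv_mul_mem (d : Equiv.Perm (Fin 6)) :
    ∃ p, (cosetRep p)⁻¹ * d ∈ G := by
  let f : (Fin 5 × Fin 3 × Fin 2) × rotations → Equiv.Perm (Fin 6) :=
    fun x => cosetRep x.1 * x.2
  have hf : Function.Injective f := by
    rintro ⟨p, g, hg⟩ ⟨q, h, hh⟩ hpq
    simp only [f] at hpq
    have hp : p = q := by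
      refine cosetRep_inv_mul_mem p q (mem_G_iff.1 ?_)
      rw [show (cosetRep p)⁻¹ * cosetRep q = g * h⁻¹ by
        rw [eq_mul_inv_iff_mul_eq, mul_assoc, ← hpq, inv_mul_cancel_left]]
      exact G.mul_mem (mem_G_iff.2 hg) (G.inv_mem (mem_G_iff.2 hh))
    subst hp
    simpa using hpq
  have hbij : Function.Bijective f := (Fintype.bijective_iff_injective_and_card f).2
    ⟨hf, by simp [Fintype.card_perm, card_rotations, Nat.factorial]⟩
  obtain ⟨⟨p, g, hg⟩, rfl⟩ := hbij.2 d
  exact ⟨p, by simpa [f] using mem_G_iff.2 hg⟩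

theorem varietyOf_mul_cosetRep_bijective (c : CCube) :
    Function.Bijective fun p => varietyOf (c * cosetRep p) := by
  constructor
  · intro p q h
    have h := mem_G_iff.1 (varietyOf_eq_iff.1 h)
    exact cosetRep_inv_mul_mem p q (by simpa [mul_assoc] using h)
  · intro w
    obtain ⟨d, rfl⟩ := Quotient.exists_rep w
    obtain ⟨p, hp⟩ := exists_cosetRep_inv_mul_mem (c⁻¹ * d)
    exact ⟨p, varietyOf_eq_iff.2 (by simpa [mul_assoc] using hp)⟩

/-- The indices of the coset representatives other than the identity that share `a` opposite
pairs and `b` corner triples with the identity. -/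
def neighborIndices (a b : ℕ) : Finset (Fin 5 × Fin 3 × Fin 2) :=
  Finset.univ.filter fun p => p ≠ (0, 0, 0) ∧ (oppPairs 1 ∩ oppPairs (cosetRep p)).card = a ∧
    (explicitCornerTriples 1 ∩ explicitCornerTriples (cosetRep p)).card = b

theorem setOf_neighbors_eq_image (c : CCube) (a b : ℕ) :
    {w : Variety | w ≠ varietyOf c ∧ (vOpp (varietyOf c) ∩ vOpp w).card = a ∧
      (vCorners (varietyOf c) ∩ vCorners w).card = b} =
      (fun p => varietyOf (c * cosetRep p)) '' neighborIndices a b := by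
  have hbij := varietyOf_mul_cosetRep_bijective c
  have h0 : varietyOf c = varietyOf (c * cosetRep (0, 0, 0)) := by
    rw [show cosetRep (0, 0, 0) = 1 by decide, mul_one]
  rw [← Set.image_preimage_eq {w : Variety | _} hbij.2]
  congr 1
  ext p
  have hne : varietyOf (c * cosetRep p) ≠ varietyOf c ↔ p ≠ (0, 0, 0) := by
    rw [h0]
    exact hbij.1.ne_iff
  simp only [Set.mem_preimage, Set.mem_ofPred_eq, hne, vOpp_varietyOf, vCorners_varietyOf,
    card_oppPairs_inter_mul, card_cornerTriples_inter_mul, ← cornerTriples_eq_explicit,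
    neighborIndices, Finset.coe_filter, Finset.mem_univ, true_and]

theorem ncard_setOf_neighbors (c : CCube) (a b : ℕ) :
    {w : Variety | w ≠ varietyOf c ∧ (vOpp (varietyOf c) ∩ vOpp w).card = a ∧
      (vCorners (varietyOf c) ∩ vCorners w).card = b}.ncard = (neighborIndices a b).card := by
  rw [setOf_neighbors_eq_image,
    Set.ncard_image_of_injective _ (varietyOf_mul_cosetRep_bijective c).1, Set.ncard_coe_finset]

theorem neighborIndices_mirror : neighborIndices 3 0 = {(0, 2, 0)} := by decide +kernel

theorem card_neighborIndices : (neighborIndices 1 2).card = 12 ∧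
    (neighborIndices 0 2).card = 8 ∧ (neighborIndices 0 0).card = 8 := by
  decide +kernel

/-- Among the 29 varieties other than `v`: exactly one (the mirror variety) shares all three
opposite pairs and no corner triples with `v`; exactly twelve share exactly one opposite pair
and exactly two corner triples; exactly eight share no opposite pairs and exactly two corner
triples; and exactly eight share no opposite pairs and no corner triples. -/
theorem variety_neighbors (v : Variety) :
    ({w : Variety | w ≠ v ∧ (vOpp v ∩ vOpp w).card = 3 ∧ (vCorners v ∩ vCorners w).card = 0}
      = {vMirror v}) ∧
    {w : Variety | w ≠ v ∧ (vOpp v ∩ vOpp w).card = 1 ∧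
      (vCorners v ∩ vCorners w).card = 2}.ncard = 12 ∧
    {w : Variety | w ≠ v ∧ (vOpp v ∩ vOpp w).card = 0 ∧
      (vCorners v ∩ vCorners w).card = 2}.ncard = 8 ∧
    {w : Variety | w ≠ v ∧ (vOpp v ∩ vOpp w).card = 0 ∧
      (vCorners v ∩ vCorners w).card = 0}.ncard = 8 := by
  obtain ⟨c, hc, hm⟩ : ∃ c, varietyOf c = v ∧ vMirror v = varietyOf (mirror c) :=
    ⟨Quotient.out v, Quotient.out_eq v, rfl⟩
  rw [hm]
  subst hc
  simp only [ncard_setOf_neighbors]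
  refine ⟨?_, card_neighborIndices⟩
  rw [setOf_neighbors_eq_image, neighborIndices_mirror, Finset.coe_singleton,
    Set.image_singleton, Set.singleton_eq_singleton_iff, varietyOf_eq_iff, mem_G_iff, mirror,
    mul_inv_rev, mul_assoc, inv_mul_cancel_left]
  decide +kernel
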